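/- Let C be a small category, x an object of C, and suppose any two objects of C are isomorphic (equivalently, C is equivalent to a category with one object). Then the universal monoid U(C) is isomorphic, as a monoid, to the coproduct (free product) of the endomorphism monoid End_C(x) with the free group on the set of objects of C other than x. -/

import Mathlib

open CategoryTheory

/-- The set of all morphisms of a small category `C`. -/
abbrev Mor (C : Type) [SmallCategory C] : Type := Σ x y : C, x ⟶ y

/-- The generating relations for the universal monoid `U(C)` on a small category `C`:
the identity `id_x` of each object is related to `1`, and the composite `g ∘ f` of a
composable pair is related to the product of the generators corresponding to `f` and
`g` (multiplication being written in the same order as classical composition, matching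
the convention `f ≫ g = g * f` of `CategoryTheory.SingleObj` and `CategoryTheory.End`). -/
def uRel (C : Type) [SmallCategory C] :
    FreeMonoid (Mor C) → FreeMonoid (Mor C) → Prop := fun a b =>
  (∃ x : C, a = FreeMonoid.of ⟨x, x, 𝟙 x⟩ ∧ b = 1) ∨
  (∃ (x y z : C) (f : x ⟶ y) (g : y ⟶ z),
    a = FreeMonoid.of ⟨x, z, f ≫ g⟩ ∧
    b = FreeMonoid.of ⟨y, z, g⟩ * FreeMonoid.of ⟨x, y, f⟩)

/-- The universal monoid `U(C)` of a small category `C`: the quotient of the free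
monoid on the set of all morphisms of `C` by the monoid congruence generated by the
relations `id_x ~ 1` and `(g ∘ f) ~ g·f`. -/
abbrev UMon (C : Type) [SmallCategory C] : Type := (conGen (uRel C)).Quotient

/-- The class `⟦f⟧` in `U(C)` of a morphism `f` of `C`. -/
def UMon.mk {C : Type} [SmallCategory C] {x y : C} (f : x ⟶ y) : UMon C :=
  (conGen (uRel C)).mk' (FreeMonoid.of ⟨x, y, f⟩)

namespace UMon

open scoped Classical in
/-- The free generator attached to an object, the base object being sent to `1`. -/
noncomputable def gen {C : Type} (x y : C) : FreeGroup {y : C // y ≠ x} :=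
  if h : y ≠ x then FreeGroup.of ⟨y, h⟩ else 1

@[simp]
lemma gen_self {C : Type} (x : C) : gen x x = 1 := by simp [gen]

@[simp]
lemma gen_coe {C : Type} {x : C} (y : {y : C // y ≠ x}) : gen x y = FreeGroup.of y := by
  simp [gen, y.2]

variable {C : Type} [SmallCategory C]

lemma mk_id (y : C) : mk (𝟙 y) = 1 :=
  (Con.eq _).2 (ConGen.Rel.of _ _ (Or.inl ⟨y, rfl, rfl⟩))

lemma mk_comp {y z w : C} (f : y ⟶ z) (g : z ⟶ w) : mk (f ≫ g) = mk g * mk f :=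
  (Con.eq _).2 (ConGen.Rel.of _ _ (Or.inr ⟨y, z, w, f, g, rfl, rfl⟩))

/-- The homomorphism out of `U(C)` induced by an assignment on morphisms which sends identities
to `1` and composites to products. -/
def lift {M : Type*} [Monoid M] (φ : ∀ {y z : C}, (y ⟶ z) → M) (hid : ∀ y : C, φ (𝟙 y) = 1)
    (hcomp : ∀ {y z w : C} (f : y ⟶ z) (g : z ⟶ w), φ (f ≫ g) = φ g * φ f) : UMon C →* M :=
  (conGen (uRel C)).lift (FreeMonoid.lift fun m => φ m.2.2) <| by
    refine Con.conGen_le.2 ?_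
    rintro a b (⟨y, rfl, rfl⟩ | ⟨y, z, w, f, g, rfl, rfl⟩)
    · simp [Con.ker_rel, hid]
    · simp [Con.ker_rel, hcomp]

lemma hom_ext {M : Type*} [Monoid M] {F G : UMon C →* M}
    (h : ∀ {y z : C} (f : y ⟶ z), F (mk f) = G (mk f)) : F = G :=
  Con.hom_ext <| FreeMonoid.hom_eq fun m => h m.2.2

/-- The inclusion of an endomorphism monoid into `U(C)`. -/
def ofEnd (x : C) : End x →* UMon C where
  toFun a := mk a
  map_one' := mk_id x
  map_mul' a b := mk_comp b a

/-- The class of an isomorphism, as a unit of `U(C)`. -/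
def unitOfIso {y z : C} (e : y ≅ z) : (UMon C)ˣ where
  val := mk e.hom
  inv := mk e.inv
  val_inv := by rw [← mk_comp, e.inv_hom_id, mk_id]
  inv_val := by rw [← mk_comp, e.hom_inv_id, mk_id]

section Coprod

open Monoid.Coprod

variable {x : C} (e : ∀ y : C, x ≅ y)

/-- Transport of a morphism to an endomorphism of the base object along chosen isomorphisms. -/
def conjEnd {y z : C} (f : y ⟶ z) : End x := (e y).hom ≫ f ≫ (e z).inv

lemma conjEnd_id (y : C) : conjEnd e (𝟙 y) = 1 := by
  simp [conjEnd, End.one_def]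

lemma conjEnd_comp {y z w : C} (f : y ⟶ z) (g : z ⟶ w) :
    conjEnd e (f ≫ g) = conjEnd e g * conjEnd e f := by
  simp [conjEnd, End.mul_def]

/-- The homomorphism from `U(C)` to the coproduct determined by chosen isomorphisms. -/
noncomputable def toCoprod : UMon C →* Monoid.Coprod (End x) (FreeGroup {y : C // y ≠ x}) :=
  lift (fun {y z} f => inr (gen x z) * inl (conjEnd e f) * inr (gen x y)⁻¹)
    (fun y => by rw [conjEnd_id, map_one, mul_one, ← map_mul, mul_inv_cancel, map_one])
    (fun {y z w} f g => by
      have hz : (inr (gen x z)⁻¹ : Monoid.Coprod (End x) _) * inr (gen x z) = 1 := by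
        rw [← map_mul, inv_mul_cancel, map_one]
      simp only [conjEnd_comp, map_mul, mul_assoc]
      rw [← mul_assoc (inr (gen x z)⁻¹) (inr (gen x z)), hz, one_mul])

@[simp]
lemma toCoprod_mk {y z : C} (f : y ⟶ z) :
    toCoprod e (mk f) = inr (gen x z) * inl (conjEnd e f) * inr (gen x y)⁻¹ :=
  rfl

/-- The homomorphism from the free group on the other objects to the units of `U(C)`. -/
def freeGroupToUnits : FreeGroup {y : C // y ≠ x} →* (UMon C)ˣ :=
  FreeGroup.lift fun y => unitOfIso (e y)

/-- The homomorphism from the coproduct to `U(C)` determined by chosen isomorphisms. -/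
def ofCoprod : Monoid.Coprod (End x) (FreeGroup {y : C // y ≠ x}) →* UMon C :=
  Monoid.Coprod.lift (ofEnd x) ((Units.coeHom _).comp (freeGroupToUnits e))

variable {e}

lemma freeGroupToUnits_gen (he : e x = Iso.refl x) (y : C) :
    freeGroupToUnits e (gen x y) = unitOfIso (e y) := by
  by_cases h : y = x
  · subst h
    rw [gen_self, map_one, he]
    exact Units.ext (mk_id _).symm
  · simp [gen, h, freeGroupToUnits]

lemma ofCoprod_comp_toCoprod (he : e x = Iso.refl x) :
    (ofCoprod e).comp (toCoprod e) = MonoidHom.id _ := by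
  refine hom_ext fun {y z} f => ?_
  have hmk : (ofCoprod e) (toCoprod e (mk f)) =
      mk (e z).hom * mk ((e y).hom ≫ f ≫ (e z).inv) * mk (e y).inv := by
    simp only [toCoprod_mk, ofCoprod, map_mul, lift_apply_inr, lift_apply_inl,
      MonoidHom.comp_apply, map_inv, freeGroupToUnits_gen he]
    rfl
  simp only [MonoidHom.comp_apply, hmk, MonoidHom.id_apply, ← mk_comp]
  simp

lemma toCoprod_comp_ofCoprod (he : e x = Iso.refl x) :
    (toCoprod e).comp (ofCoprod e) = MonoidHom.id _ := by
  refine Monoid.Coprod.hom_ext (MonoidHom.ext fun a => ?_) (FreeGroup.ext_hom _ _ fun y => ?_)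
  · have ha : conjEnd e a = a := by simp [conjEnd, he]
    change toCoprod e (mk a) = inl a
    simp [ha]
  · have hy : ofCoprod e (inr (FreeGroup.of y)) = mk (e y).hom := by
      simp [ofCoprod, freeGroupToUnits, unitOfIso]
    have hc : conjEnd e (e y).hom = 1 := by simp [conjEnd, he, End.one_def]
    change toCoprod e (ofCoprod e (inr (FreeGroup.of y))) = inr (FreeGroup.of y)
    rw [hy, toCoprod_mk, hc, gen_coe, gen_self, map_one, inv_one, map_one, mul_one, mul_one]

end Coprod

end UMon

/-- Let `C` be a small category in which any two objects are isomorphic (equivalently,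
`C` is equivalent to a category with one object), and let `x` be an object of `C`.
Then the universal monoid `U(C)` is isomorphic, as a monoid, to the coproduct (free
product) of the endomorphism monoid `End x` with the free group on the set of objects
of `C` other than `x`. -/
theorem uMon_iso_coprod_end_freeGroup (C : Type) [SmallCategory C] (x : C)
    (h : ∀ y z : C, Nonempty (y ≅ z)) :
    Nonempty (UMon C ≃*
      Monoid.Coprod (CategoryTheory.End x) (FreeGroup {y : C // y ≠ x})) := by
  classical
  obtain ⟨e, he⟩ : ∃ e : ∀ y : C, x ≅ y, e x = Iso.refl x :=
    ⟨Function.update (fun y => (h x y).some) x (Iso.refl x), Function.update_self ..⟩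
  exact ⟨MonoidHom.toMulEquiv (UMon.toCoprod e) (UMon.ofCoprod e)
    (UMon.ofCoprod_comp_toCoprod he) (UMon.toCoprod_comp_ofCoprod he)⟩
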